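/- For every continuous A : Σ → SL₂(ℝ), one has ∫₀¹ L(A·R_{2πθ}) dθ = ∫_Σ log((‖A(x)‖ + ‖A(x)‖^{-1})/2) dμ(x), where R_α ∈ SL₂(ℝ) denotes the rotation by angle α and A·R_{2πθ} denotes the cocycle x ↦ A(x)·R_{2πθ}. (Avila–Bochi regularization formula.) -/

import Mathlib

open MeasureTheory

noncomputable section

abbrev Mat2 : Type := Matrix (Fin 2) (Fin 2) ℝ
abbrev SL2 : Type := Matrix.SpecialLinearGroup (Fin 2) ℝ
abbrev E2 : Type := EuclideanSpace ℝ (Fin 2)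
abbrev Pone : Type := Projectivization ℝ E2

instance : TopologicalSpace SL2 :=
  inferInstanceAs (TopologicalSpace { A : Mat2 // A.det = 1 })

/-- The operator norm of a 2×2 real matrix, acting on Euclidean ℝ². -/
def opNorm (M : Mat2) : ℝ := ‖Matrix.toEuclideanCLM (𝕜 := ℝ) M‖

/-- The continuous linear map on Euclidean ℝ² induced by a matrix in SL₂(ℝ). -/
def toEuc (g : SL2) : E2 →L[ℝ] E2 := Matrix.toEuclideanCLM (𝕜 := ℝ) (g : Mat2)

lemma toEuc_injective (g : SL2) : Function.Injective (toEuc g) := by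
  intro x y hxy
  have key : ∀ z, toEuc g⁻¹ (toEuc g z) = z := by
    intro z
    have h1 : ((g⁻¹ : SL2) : Mat2) * (g : Mat2) = 1 := by
      rw [← Matrix.SpecialLinearGroup.coe_mul, inv_mul_cancel,
        Matrix.SpecialLinearGroup.coe_one]
    calc toEuc g⁻¹ (toEuc g z)
        = (Matrix.toEuclideanCLM (𝕜 := ℝ) (((g⁻¹ : SL2) : Mat2) * (g : Mat2))) z := by
          rw [map_mul]; rfl
      _ = z := by rw [h1, map_one]; rfl
  have := congrArg (toEuc g⁻¹) hxy
  rwa [key, key] at this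

/-- The projective action of SL₂(ℝ) on the real projective line ℙ¹. -/
def pact (g : SL2) : Pone → Pone :=
  Projectivization.map (toEuc g).toLinearMap (toEuc_injective g)

instance : MeasurableSpace Pone :=
  inferInstanceAs (MeasurableSpace (Quotient (projectivizationSetoid ℝ E2)))

instance : TopologicalSpace Pone :=
  inferInstanceAs (TopologicalSpace (Quotient (projectivizationSetoid ℝ E2)))

/-- The space `Σ = {1,…,κ}^ℤ` of bilateral sequences in `κ` symbols. -/
abbrev Sig (κ : ℕ) : Type := ℤ → Fin κ

/-- The left shift map `σ((x_n)_n) = (x_{n+1})_n`. -/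
def shift {κ : ℕ} (x : Sig κ) : Sig κ := fun n => x (n + 1)

/-- The cocycle iterates: `A^n(x) = A(σ^{n-1}x) ⋯ A(σ x) A(x)`. -/
def cocycleN {κ : ℕ} (A : Sig κ → SL2) : ℕ → Sig κ → SL2
  | 0, _ => 1
  | n + 1, x => cocycleN A n (shift x) * A x

/-- `μ` is the Bernoulli measure `p^ℤ` on `Σ`: a probability measure giving each
cylinder its product measure. -/
def IsBernoulli {κ : ℕ} (p : Fin κ → ℝ) (μ : Measure (Sig κ)) : Prop :=
  IsProbabilityMeasure μ ∧
    ∀ (s : Finset ℤ) (a : ℤ → Fin κ),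
      μ {x | ∀ n ∈ s, x n = a n} = ∏ n ∈ s, ENNReal.ofReal (p (a n))

/-- The Lyapunov exponent `L(A) = inf_{n ≥ 1} (1/n) ∫_Σ log‖A^n(x)‖ dμ(x)`. -/
def lyap {κ : ℕ} (μ : Measure (Sig κ)) (A : Sig κ → SL2) : ℝ :=
  ⨅ n : {m : ℕ // 0 < m},
    (((n : ℕ) : ℝ))⁻¹ * ∫ x, Real.log (opNorm ((cocycleN A (n : ℕ) x : SL2) : Mat2)) ∂μ

/-- The rotation by angle `θ`, as an element of SL₂(ℝ). -/
def rot (θ : ℝ) : SL2 :=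
  ⟨!![Real.cos θ, -Real.sin θ; Real.sin θ, Real.cos θ], by
    rw [Matrix.det_fin_two_of]; nlinarith [Real.sin_sq_add_cos_sq θ]⟩

/-! ### Conformal and anticonformal parts of a real 2×2 matrix -/

/-- Conformal part. -/
def al (M : Mat2) : ℂ := ⟨(M 0 0 + M 1 1) / 2, (M 1 0 - M 0 1) / 2⟩
/-- Anticonformal part. -/
def be (M : Mat2) : ℂ := ⟨(M 0 0 - M 1 1) / 2, (M 1 0 + M 0 1) / 2⟩

lemma al_mul (M N : Mat2) :
    al (M * N) = al M * al N + be M * (starRingEnd ℂ) (be N) := by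
  apply Complex.ext <;> simp [al, be, Matrix.mul_apply, Fin.sum_univ_two] <;> ring

lemma be_mul (M N : Mat2) :
    be (M * N) = al M * be N + be M * (starRingEnd ℂ) (al N) := by
  apply Complex.ext <;> simp [al, be, Matrix.mul_apply, Fin.sum_univ_two] <;> ring

lemma normSq_al_be (g : SL2) : ‖al (g : Mat2)‖ ^ 2 - ‖be (g : Mat2)‖ ^ 2 = 1 := by
  have h := g.det_coe
  rw [Matrix.det_fin_two] at h
  rw [← Complex.normSq_eq_norm_sq, ← Complex.normSq_eq_norm_sq]
  simp only [al, be, Complex.normSq_mk]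
  linarith

lemma one_le_al (g : SL2) : 1 ≤ ‖al (g : Mat2)‖ := by
  nlinarith [normSq_al_be g, sq_nonneg ‖be (g : Mat2)‖, norm_nonneg (al (g : Mat2))]

/-- Identification of the Euclidean plane with ℂ. -/
def cl (v : E2) : ℂ := ⟨v 0, v 1⟩

lemma norm_cl (v : E2) : ‖cl v‖ = ‖v‖ := by
  rw [EuclideanSpace.norm_eq, Complex.norm_def]
  simp [cl, Complex.normSq_mk, Fin.sum_univ_two, sq]

lemma cl_apply (M : Mat2) (v : E2) :
    cl (Matrix.toEuclideanCLM (𝕜 := ℝ) M v) =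
      al M * cl v + be M * (starRingEnd ℂ) (cl v) := by
  apply Complex.ext <;>
    simp [al, be, cl, Matrix.mulVec, dotProduct, Fin.sum_univ_two] <;> ring

lemma opNorm_eq (M : Mat2) : opNorm M = ‖al M‖ + ‖be M‖ := by
  apply le_antisymm
  · refine ContinuousLinearMap.opNorm_le_bound _ (by positivity) fun v => ?_
    rw [← norm_cl, cl_apply, ← norm_cl v]
    refine (norm_add_le _ _).trans ?_
    rw [norm_mul, norm_mul, RCLike.norm_conj]
    exact (add_mul _ _ _).ge
  · set t : ℝ := (Complex.arg (be M) - Complex.arg (al M)) / 2 with ht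
    set c : ℂ := Complex.exp (t * Complex.I) with hc
    set v : E2 := !₂[c.re, c.im] with hv
    have hcl : cl v = c := by apply Complex.ext <;> simp [cl, hv]
    have hcn : ‖c‖ = 1 := Complex.norm_exp_ofReal_mul_I t
    have hvn : ‖v‖ = 1 := by rw [← norm_cl, hcl, hcn]
    have key : ‖Matrix.toEuclideanCLM (𝕜 := ℝ) M v‖ = ‖al M‖ + ‖be M‖ := by
      rw [← norm_cl, cl_apply, hcl]
      have hconj : (starRingEnd ℂ) c = Complex.exp (-(t * Complex.I)) := by
        rw [hc, ← Complex.exp_conj]; simp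
      set s : ℝ := (Complex.arg (be M) + Complex.arg (al M)) / 2 with hs
      have h1 : al M * c = ‖al M‖ * Complex.exp (s * Complex.I) := by
        conv_lhs => rw [← Complex.norm_mul_exp_arg_mul_I (al M)]
        rw [hc, mul_assoc, ← Complex.exp_add]
        congr 2; rw [ht, hs]; push_cast; ring
      have h2 : be M * (starRingEnd ℂ) c = ‖be M‖ * Complex.exp (s * Complex.I) := by
        rw [hconj]
        conv_lhs => rw [← Complex.norm_mul_exp_arg_mul_I (be M)]
        rw [mul_assoc, ← Complex.exp_add]
        congr 2; rw [ht, hs]; push_cast; ring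
      rw [h1, h2, ← add_mul, norm_mul, Complex.norm_exp_ofReal_mul_I, mul_one,
        ← Complex.ofReal_add, Complex.norm_of_nonneg (by positivity)]
    have := (Matrix.toEuclideanCLM (𝕜 := ℝ) M).le_opNorm v
    rw [key, hvn, mul_one] at this
    exact this

lemma half_opNorm (g : SL2) :
    (opNorm (g : Mat2) + (opNorm (g : Mat2))⁻¹) / 2 = ‖al (g : Mat2)‖ := by
  have h := normSq_al_be g
  have h1 := one_le_al g
  rw [opNorm_eq]
  have h2 : (‖al (g : Mat2)‖ + ‖be (g : Mat2)‖)⁻¹ = ‖al (g : Mat2)‖ - ‖be (g : Mat2)‖ := by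
    apply inv_eq_of_mul_eq_one_right
    linarith
  rw [h2]; ring

lemma al_le_opNorm (g : SL2) : ‖al (g : Mat2)‖ ≤ opNorm (g : Mat2) := by
  rw [opNorm_eq]; linarith [norm_nonneg (be (g : Mat2))]

lemma opNorm_le_al (g : SL2) : opNorm (g : Mat2) ≤ 2 * ‖al (g : Mat2)‖ := by
  rw [opNorm_eq]
  have : ‖be (g : Mat2)‖ ≤ ‖al (g : Mat2)‖ :=
    abs_le_of_sq_le_sq' (by linarith [normSq_al_be g]) (norm_nonneg _) |>.2
  linarith

lemma one_le_opNorm (g : SL2) : 1 ≤ opNorm (g : Mat2) := (one_le_al g).trans (al_le_opNorm g)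

lemma opNorm_mul_le (M N : Mat2) : opNorm (M * N) ≤ opNorm M * opNorm N := by
  unfold opNorm
  rw [map_mul]
  exact norm_mul_le _ _

lemma al_rot (t : ℝ) : al (rot t : Mat2) = Complex.exp (t * Complex.I) := by
  rw [Complex.exp_mul_I, ← Complex.ofReal_cos, ← Complex.ofReal_sin]
  apply Complex.ext <;> simp [al, rot, -Complex.ofReal_cos, -Complex.ofReal_sin]

lemma be_rot (t : ℝ) : be (rot t : Mat2) = 0 := by
  apply Complex.ext <;> simp [be, rot]

/-! ### The polynomial extension of the rotated cocycle -/

/-- The pair of polynomials in `z` extending the rotated cocycle. -/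
def pq {κ : ℕ} (A : Sig κ → SL2) (z : ℂ) : ℕ → Sig κ → ℂ × ℂ
  | 0, _ => (1, 0)
  | n + 1, x =>
    ((pq A z n (shift x)).1 * (starRingEnd ℂ) (al (A x : Mat2))
        + (pq A z n (shift x)).2 * be (A x : Mat2),
      z ^ 2 * ((pq A z n (shift x)).1 * (starRingEnd ℂ) (be (A x : Mat2))
        + (pq A z n (shift x)).2 * al (A x : Mat2)))

lemma pq_analytic {κ : ℕ} (A : Sig κ → SL2) (n : ℕ) (x : Sig κ) :
    Differentiable ℂ (fun z => (pq A z n x).1) ∧ Differentiable ℂ (fun z => (pq A z n x).2) := by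
  induction n generalizing x with
  | zero => simp [pq]
  | succ n ih =>
    obtain ⟨h1, h2⟩ := ih (shift x)
    simp only [pq]
    constructor <;> fun_prop

lemma pq_zero {κ : ℕ} (A : Sig κ → SL2) (n : ℕ) (x : Sig κ) :
    (pq A 0 n x).1 = ∏ k ∈ Finset.range n, (starRingEnd ℂ) (al (A (shift^[k] x) : Mat2)) ∧
      (pq A 0 n x).2 = 0 := by
  induction n generalizing x with
  | zero => simp [pq]
  | succ n ih =>
    obtain ⟨h1, h2⟩ := ih (shift x)
    simp only [pq, h1, h2, Finset.prod_range_succ']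
    simp

lemma form_id (a b α β : ℂ) :
    ‖a * (starRingEnd ℂ) α + b * β‖ ^ 2 - ‖a * (starRingEnd ℂ) β + b * α‖ ^ 2
      = (‖a‖ ^ 2 - ‖b‖ ^ 2) * (‖α‖ ^ 2 - ‖β‖ ^ 2) := by
  simp only [← Complex.normSq_eq_norm_sq, Complex.normSq_apply]
  simp
  ring

lemma pq_cone {κ : ℕ} (A : Sig κ → SL2) {z : ℂ} (hz : ‖z‖ ≤ 1) (n : ℕ) (x : Sig κ) :
    1 ≤ ‖(pq A z n x).1‖ ^ 2 - ‖(pq A z n x).2‖ ^ 2 := by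
  induction n generalizing x with
  | zero => simp [pq]
  | succ n ih =>
    have h := ih (shift x)
    have h2 := form_id (pq A z n (shift x)).1 (pq A z n (shift x)).2
      (al (A x : Mat2)) (be (A x : Mat2))
    rw [normSq_al_be, mul_one] at h2
    simp only [pq]
    rw [norm_mul, mul_pow, norm_pow]
    have h3 : (‖z‖ ^ 2) ^ 2 ≤ 1 := pow_le_one₀ (by positivity) (pow_le_one₀ (by positivity) hz)
    nlinarith [mul_le_mul_of_nonneg_right h3 (sq_nonneg ‖(pq A z n (shift x)).1 *
      (starRingEnd ℂ) (be (A x : Mat2)) + (pq A z n (shift x)).2 * al (A x : Mat2)‖)]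

lemma pq_circle {κ : ℕ} (A : Sig κ → SL2) (t : ℝ) (n : ℕ) (x : Sig κ) :
    (pq A (Complex.exp (t * Complex.I)) n x).1 = Complex.exp (t * Complex.I) ^ n *
        (starRingEnd ℂ) (al (cocycleN (fun x => A x * rot t) n x : Mat2)) ∧
    (pq A (Complex.exp (t * Complex.I)) n x).2 = Complex.exp (t * Complex.I) ^ n *
        (starRingEnd ℂ) (be (cocycleN (fun x => A x * rot t) n x : Mat2)) := by
  have hz : Complex.exp (t * Complex.I) * (starRingEnd ℂ) (Complex.exp (t * Complex.I)) = 1 := by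
    rw [Complex.mul_conj, Complex.normSq_eq_norm_sq, Complex.norm_exp_ofReal_mul_I]; simp
  induction n generalizing x with
  | zero => 
    simp only [pq, cocycleN]
    constructor <;> apply Complex.ext <;> simp [al, be]
  | succ n ih =>
    obtain ⟨h1, h2⟩ := ih (shift x)
    simp only [pq, cocycleN, h1, h2, Matrix.SpecialLinearGroup.coe_mul]
    simp only [al_mul, be_mul, be_rot, al_rot]
    set z := Complex.exp (t * Complex.I)
    simp only [map_add, map_mul, map_zero, mul_zero, zero_add, add_zero, Complex.conj_conj]
    constructor
    · linear_combination (-z ^ n * ((starRingEnd ℂ) (al (cocycleN (fun x => A x * rot t) n (shift x) : Mat2)) * (starRingEnd ℂ) (al (A x : Mat2)) + (starRingEnd ℂ) (be (cocycleN (fun x => A x * rot t) n (shift x) : Mat2)) * be (A x : Mat2))) * hz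
    · ring

lemma circle_formula {κ : ℕ} (A : Sig κ → SL2) (n : ℕ) (x : Sig κ) :
    ∫ θ in (0:ℝ)..1, Real.log ‖al (cocycleN (fun x => A x * rot (2 * Real.pi * θ)) n x : Mat2)‖ =
      ∑ k ∈ Finset.range n, Real.log ‖al (A (shift^[k] x) : Mat2)‖ := by
  have h := AnalyticOnNhd.circleAverage_log_norm_of_ne_zero (R := 1) (c := 0)
    (g := fun z => (pq A z n x).1)
    (fun z _ => (pq_analytic A n x).1.analyticAt z) (by
      intro z hz h0
      have hz' : ‖z‖ ≤ 1 := by simpa using hz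
      have := pq_cone A hz' n x
      change (pq A z n x).1 = 0 at h0
      rw [h0] at this
      simp at this
      nlinarith [sq_nonneg ‖(pq A z n x).2‖])
  rw [(pq_zero A n x).1, norm_prod, Real.log_prod] at h
  · simp only [RCLike.norm_conj] at h
    rw [← h, Real.circleAverage_def]
    have hfun : ∀ t : ℝ, Real.log ‖(pq A (circleMap 0 1 t) n x).1‖ =
        Real.log ‖al (cocycleN (fun x => A x * rot t) n x : Mat2)‖ := by
      intro t
      have : circleMap 0 1 t = Complex.exp (t * Complex.I) := by simp [circleMap]
      rw [this, (pq_circle A t n x).1, norm_mul, norm_pow, Complex.norm_exp_ofReal_mul_I,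
        RCLike.norm_conj]
      simp
    simp only [hfun]
    rw [intervalIntegral.integral_comp_mul_left
      (fun t => Real.log ‖al (cocycleN (fun x => A x * rot t) n x : Mat2)‖)
      (by positivity : (2 * Real.pi) ≠ 0)]
    simp
  · intro k _
    rw [RCLike.norm_conj]
    linarith [one_le_al (A (shift^[k] x))]

/-! ### Shift invariance and continuity -/

lemma continuous_shift {κ : ℕ} : Continuous (shift : Sig κ → Sig κ) :=
  continuous_pi fun n => continuous_apply (n + 1)

lemma shift_mp {κ : ℕ} (hκ : 2 ≤ κ) (p : Fin κ → ℝ) (μ : Measure (Sig κ))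
    (hμ : IsBernoulli p μ) : MeasurePreserving shift μ μ := by
  have := hμ.1
  have hm : Measurable (shift : Sig κ → Sig κ) :=
    measurable_pi_lambda _ fun n => measurable_pi_apply (n + 1)
  refine ⟨hm, ?_⟩
  have : ∀ I : Finset ℤ, IsFiniteMeasure (μ.map I.restrict) := fun I => inferInstance
  refine IsProjectiveLimit.unique (P := fun I : Finset ℤ => μ.map I.restrict) ?_ (fun I => rfl)
  intro I
  apply Measure.ext_of_singleton
  intro b
  have hr : Measurable (I.restrict : Sig κ → (i : I) → Fin κ) := Finset.measurable_restrict I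
  rw [Measure.map_map hr hm, Measure.map_apply (hr.comp hm) (measurableSet_singleton _),
    Measure.map_apply hr (measurableSet_singleton _)]
  let a : ℤ → Fin κ := fun n => if h : n ∈ I then b ⟨n, h⟩ else ⟨0, by omega⟩
  have h1 : (I.restrict : Sig κ → (i : I) → Fin κ) ⁻¹' {b} = {x : Sig κ | ∀ n ∈ I, x n = a n} := by
    ext x
    simp only [Set.mem_preimage, Set.mem_singleton_iff, Set.mem_ofPred_eq, funext_iff]
    constructor
    · intro h n hn
      simpa [a, hn] using h ⟨n, hn⟩
    · rintro h ⟨n, hn⟩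
      simpa [a, hn] using h n hn
  have h2 : ((I.restrict : Sig κ → (i : I) → Fin κ) ∘ shift) ⁻¹' {b} =
      {x : Sig κ | ∀ n ∈ I.map (addRightEmbedding 1), x n = a (n - 1)} := by
    rw [Set.preimage_comp, h1]
    ext x
    simp [shift]
  rw [h1, h2, hμ.2 _ (fun n => a (n - 1)), hμ.2, Finset.prod_map]
  simp

lemma coe_continuous {κ : ℕ} {A : Sig κ → SL2} (hA : Continuous A) :
    Continuous (fun x => (A x : Mat2)) := continuous_subtype_val.comp hA

lemma cocycle_continuous {κ : ℕ} {A : Sig κ → SL2} (hA : Continuous A) (n : ℕ) :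
    Continuous (fun q : ℝ × Sig κ =>
      (cocycleN (fun x => A x * rot (2 * Real.pi * q.1)) n q.2 : Mat2)) := by
  induction n with
  | zero => simp only [cocycleN]; exact continuous_const
  | succ n ih =>
    simp only [cocycleN, Matrix.SpecialLinearGroup.coe_mul]
    have h1 := ih.comp (continuous_fst.prodMk (continuous_shift.comp continuous_snd))
    have h2 := (coe_continuous hA).comp (continuous_snd (X := ℝ))
    have h3 : Continuous (fun q : ℝ × Sig κ => (rot (2 * Real.pi * q.1) : Mat2)) := by
      refine continuous_matrix fun i j => ?_
      fin_cases i <;> fin_cases j <;> simp [rot] <;> fun_prop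
    exact h1.mul (h2.mul h3)

lemma al_continuous : Continuous al := by
  have : al = fun M : Mat2 => (((M 0 0 + M 1 1) / 2 : ℝ) : ℂ) +
      (((M 1 0 - M 0 1) / 2 : ℝ) : ℂ) * Complex.I := by
    ext M; apply Complex.ext <;> simp [al]
  rw [this]; fun_prop

lemma be_continuous : Continuous be := by
  have : be = fun M : Mat2 => (((M 0 0 - M 1 1) / 2 : ℝ) : ℂ) +
      (((M 1 0 + M 0 1) / 2 : ℝ) : ℂ) * Complex.I := by
    ext M; apply Complex.ext <;> simp [be]
  rw [this]; fun_prop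

lemma opNorm_continuous : Continuous opNorm := by
  have : opNorm = fun M => ‖al M‖ + ‖be M‖ := funext opNorm_eq
  rw [this]
  exact al_continuous.norm.add be_continuous.norm

/-- Log of the conformal part of the rotated cocycle. -/
def lal {κ : ℕ} (A : Sig κ → SL2) (n : ℕ) (θ : ℝ) (x : Sig κ) : ℝ :=
  Real.log ‖al (cocycleN (fun x => A x * rot (2 * Real.pi * θ)) n x : Mat2)‖

/-- Log-norm of the rotated cocycle. -/
def lop {κ : ℕ} (A : Sig κ → SL2) (n : ℕ) (θ : ℝ) (x : Sig κ) : ℝ :=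
  Real.log (opNorm (cocycleN (fun x => A x * rot (2 * Real.pi * θ)) n x : Mat2))

lemma lal_le_lop {κ : ℕ} (A : Sig κ → SL2) (n : ℕ) (θ : ℝ) (x : Sig κ) :
    lal A n θ x ≤ lop A n θ x :=
  Real.log_le_log (zero_lt_one.trans_le (one_le_al _)) (al_le_opNorm _)

lemma lop_le_lal {κ : ℕ} (A : Sig κ → SL2) (n : ℕ) (θ : ℝ) (x : Sig κ) :
    lop A n θ x ≤ lal A n θ x + Real.log 2 := by
  unfold lal lop
  rw [← Real.log_mul (zero_lt_one.trans_le (one_le_al _)).ne' two_ne_zero]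
  exact Real.log_le_log (zero_lt_one.trans_le (one_le_opNorm _))
    ((opNorm_le_al _).trans (mul_comm _ _).le)

lemma lal_continuous {κ : ℕ} {A : Sig κ → SL2} (hA : Continuous A) (n : ℕ) :
    Continuous (Function.uncurry (lal A n)) :=
  (al_continuous.comp (cocycle_continuous hA n)).norm.log
    fun _ => (zero_lt_one.trans_le (one_le_al _)).ne'

lemma lop_continuous {κ : ℕ} {A : Sig κ → SL2} (hA : Continuous A) (n : ℕ) :
    Continuous (Function.uncurry (lop A n)) :=
  (opNorm_continuous.comp (cocycle_continuous hA n)).log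
    fun _ => (zero_lt_one.trans_le (one_le_opNorm _)).ne'

lemma lal_continuous' {κ : ℕ} {A : Sig κ → SL2} (hA : Continuous A) (n : ℕ) (θ : ℝ) :
    Continuous (lal A n θ) := by
  have h : Continuous (fun x : Sig κ => ((θ, x) : ℝ × Sig κ)) := by fun_prop
  have h2 := (lal_continuous hA n).comp h
  exact h2

lemma lop_continuous' {κ : ℕ} {A : Sig κ → SL2} (hA : Continuous A) (n : ℕ) (θ : ℝ) :
    Continuous (lop A n θ) := by
  have h : Continuous (fun x : Sig κ => ((θ, x) : ℝ × Sig κ)) := by fun_prop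
  have h2 := (lop_continuous hA n).comp h
  exact h2

lemma integrable_cont {κ : ℕ} (μ : Measure (Sig κ)) [IsProbabilityMeasure μ] {f : Sig κ → ℝ}
    (hf : Continuous f) : Integrable f μ := by
  have := hf.continuousOn.integrableOn_compact (μ := μ) isCompact_univ
  rwa [integrableOn_univ] at this

lemma integrable_prod_cont {κ : ℕ} (μ : Measure (Sig κ)) [IsProbabilityMeasure μ]
    {f : ℝ × Sig κ → ℝ} (hf : Continuous f) :
    Integrable f ((volume.restrict (Set.Ioc (0:ℝ) 1)).prod μ) := by
  have h := hf.continuousOn.integrableOn_compact (μ := (volume : Measure ℝ).prod μ)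
    ((isCompact_Icc (a := (0:ℝ)) (b := 1)).prod (isCompact_univ (X := Sig κ)))
  have h' := h.mono_set (Set.prod_mono_left (t := Set.univ) Set.Ioc_subset_Icc_self)
  rwa [IntegrableOn, ← Measure.prod_restrict, Measure.restrict_univ] at h'

/-! ### Subadditivity -/

lemma cocycle_add {κ : ℕ} (B : Sig κ → SL2) (m n : ℕ) (x : Sig κ) :
    cocycleN B (m + n) x = cocycleN B m (shift^[n] x) * cocycleN B n x := by
  induction n generalizing x with
  | zero => simp [cocycleN]
  | succ n ih =>
    rw [← add_assoc]
    simp only [cocycleN, ih (shift x), mul_assoc, Function.iterate_succ_apply]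

/-- Integrated log-norm of the rotated cocycle. -/
def un {κ : ℕ} (μ : Measure (Sig κ)) (A : Sig κ → SL2) (θ : ℝ) (n : ℕ) : ℝ :=
  ∫ x, lop A n θ x ∂μ

lemma un_nonneg {κ : ℕ} (μ : Measure (Sig κ)) (A : Sig κ → SL2) (θ : ℝ) (n : ℕ) :
    0 ≤ un μ A θ n := integral_nonneg fun _ => Real.log_nonneg (one_le_opNorm _)

lemma un_subadd {κ : ℕ} (μ : Measure (Sig κ)) [IsProbabilityMeasure μ]
    (hs : MeasurePreserving shift μ μ) {A : Sig κ → SL2} (hA : Continuous A) (θ : ℝ) :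
    Subadditive (un μ A θ) := by
  intro m n
  have hsn := hs.iterate n
  have h1 : un μ A θ m = ∫ x, lop A m θ (shift^[n] x) ∂μ := by
    unfold un
    conv_lhs => rw [← hsn.map_eq]
    rw [integral_map hsn.measurable.aemeasurable (lop_continuous' hA m θ).aestronglyMeasurable]
  rw [h1]
  unfold un
  have hi1 : Integrable (fun x => lop A m θ (shift^[n] x)) μ :=
    integrable_cont μ ((lop_continuous' hA m θ).comp (continuous_shift.iterate n))
  have hi2 : Integrable (fun x => lop A n θ x) μ := integrable_cont μ (lop_continuous' hA n θ)
  rw [← integral_add hi1 hi2]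
  refine integral_mono (integrable_cont μ (lop_continuous' hA (m + n) θ)) (hi1.add hi2)
    fun x => ?_
  change lop A (m + n) θ x ≤ lop A m θ (shift^[n] x) + lop A n θ x
  unfold lop
  rw [cocycle_add, ← Real.log_mul (zero_lt_one.trans_le (one_le_opNorm _)).ne'
    (zero_lt_one.trans_le (one_le_opNorm _)).ne', Matrix.SpecialLinearGroup.coe_mul]
  refine Real.log_le_log ?_ (opNorm_mul_le _ _)
  rw [← Matrix.SpecialLinearGroup.coe_mul]
  exact zero_lt_one.trans_le (one_le_opNorm _)

lemma un_one {κ : ℕ} (μ : Measure (Sig κ)) (A : Sig κ → SL2) (θ : ℝ) :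
    un μ A θ 1 = ∫ x, Real.log (opNorm (A x : Mat2)) ∂μ := by
  unfold un
  congr 1; ext x
  simp only [lop, cocycleN, one_mul, Matrix.SpecialLinearGroup.coe_mul]
  rw [opNorm_eq, opNorm_eq, al_mul, be_mul, be_rot, al_rot]
  simp [Complex.norm_exp]

lemma un_bdd {κ : ℕ} (μ : Measure (Sig κ)) (A : Sig κ → SL2) (θ : ℝ) :
    BddBelow (Set.range fun n : ℕ => un μ A θ n / n) :=
  ⟨0, by rintro _ ⟨n, rfl⟩; exact div_nonneg (un_nonneg μ A θ n) n.cast_nonneg⟩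

lemma un_tendsto {κ : ℕ} (μ : Measure (Sig κ)) [IsProbabilityMeasure μ]
    (hs : MeasurePreserving shift μ μ) {A : Sig κ → SL2} (hA : Continuous A) (θ : ℝ) :
    Filter.Tendsto (fun n : ℕ => un μ A θ n / n) Filter.atTop
      (nhds (lyap μ (fun x => A x * rot (2 * Real.pi * θ)))) := by
  have h := (un_subadd μ hs hA θ).tendsto_lim (un_bdd μ A θ)
  convert h using 2
  rw [Subadditive.lim, sInf_image']
  unfold lyap
  refine Equiv.iInf_congr (Equiv.subtypeEquivRight fun n => by simp [Nat.succ_le_iff]) ?_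
  rintro ⟨n, hn⟩
  simp only [un, lop, Equiv.subtypeEquivRight_apply_coe, div_eq_inv_mul]

lemma un_le {κ : ℕ} (μ : Measure (Sig κ)) [IsProbabilityMeasure μ]
    (hs : MeasurePreserving shift μ μ) {A : Sig κ → SL2} (hA : Continuous A) (θ : ℝ) (n : ℕ) :
    un μ A θ n / n ≤ ∫ x, Real.log (opNorm (A x : Mat2)) ∂μ := by
  rw [← un_one μ A θ]
  have h0 : un μ A θ 0 = 0 := by
    unfold un
    have : opNorm (1 : Mat2) = 1 := by
      have e1 : al 1 = 1 := by apply Complex.ext <;> simp [al]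
      have e2 : be 1 = 0 := by apply Complex.ext <;> simp [be]
      rw [opNorm_eq, e1, e2]; simp
    simp [lop, cocycleN, this]
  have h := (un_subadd μ hs hA θ).apply_mul_add_le n 1 0
  rw [h0, mul_one, add_zero, add_zero] at h
  rcases Nat.eq_zero_or_pos n with rfl | hn
  · simpa using un_nonneg μ A θ 1
  · rw [div_le_iff₀ (by exact_mod_cast hn)]; linarith

/-- The exact finite-time formula. -/
lemma finite_formula {κ : ℕ} (μ : Measure (Sig κ)) [IsProbabilityMeasure μ]
    (hs : MeasurePreserving shift μ μ) {A : Sig κ → SL2} (hA : Continuous A) (n : ℕ) :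
    ∫ θ in (0:ℝ)..1, ∫ x, lal A n θ x ∂μ
      = n * ∫ x, Real.log ‖al (A x : Mat2)‖ ∂μ := by
  rw [intervalIntegral.integral_of_le zero_le_one,
    integral_integral_swap (integrable_prod_cont μ (lal_continuous hA n))]
  simp only [lal, ← intervalIntegral.integral_of_le zero_le_one, circle_formula]
  have hc : Continuous fun x => Real.log ‖al (A x : Mat2)‖ :=
    (al_continuous.comp (coe_continuous hA)).norm.log
      fun _ => (zero_lt_one.trans_le (one_le_al _)).ne'
  have gen : ∀ f : Sig κ → ℝ, Continuous f →
      ∫ x, ∑ k ∈ Finset.range n, f (shift^[k] x) ∂μ = n * ∫ x, f x ∂μ := by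
    intro f hf
    rw [integral_finsetSum (f := fun k x => f (shift^[k] x)) _
      fun k _ => integrable_cont μ (hf.comp (continuous_shift.iterate k))]
    rw [Finset.sum_congr rfl (g := fun _ => ∫ x, f x ∂μ)]
    · simp
    · intro k _
      have hsk := hs.iterate k
      conv_rhs => rw [← hsk.map_eq]
      rw [integral_map hsk.measurable.aemeasurable hf.aestronglyMeasurable]
  exact gen _ hc

/-- **Avila–Bochi regularization formula.** For every continuous cocycle
`A : Σ → SL₂(ℝ)`,
`∫₀¹ L(A·R_{2πθ}) dθ = ∫_Σ log((‖A(x)‖ + ‖A(x)‖⁻¹)/2) dμ(x)`. -/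
theorem avila_bochi_formula {κ : ℕ} (hκ : 2 ≤ κ) (p : Fin κ → ℝ)
    (hp : ∀ i, 0 < p i) (hp1 : ∑ i, p i = 1)
    (μ : Measure (Sig κ)) (hμ : IsBernoulli p μ)
    (A : Sig κ → SL2) (hA : Continuous A) :
    (∫ θ in (0:ℝ)..1, lyap μ (fun x => A x * rot (2 * Real.pi * θ))) =
      ∫ x, Real.log ((opNorm ((A x : SL2) : Mat2) + (opNorm ((A x : SL2) : Mat2))⁻¹) / 2) ∂μ := by
  have := hμ.1
  have hs := shift_mp hκ p μ hμ
  simp only [half_opNorm]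
  set J := ∫ x, Real.log ‖al (A x : Mat2)‖ ∂μ with hJ
  have hui : ∀ n, IntervalIntegrable (fun θ => un μ A θ n) volume 0 1 := fun n => by
    rw [intervalIntegrable_iff_integrableOn_Ioc_of_le zero_le_one]
    exact (integrable_prod_cont μ (lop_continuous hA n)).integral_prod_left
  have hwi : ∀ n, IntervalIntegrable (fun θ => ∫ x, lal A n θ x ∂μ) volume 0 1 := fun n => by
    rw [intervalIntegrable_iff_integrableOn_Ioc_of_le zero_le_one]
    exact (integrable_prod_cont μ (lal_continuous hA n)).integral_prod_left
  have hxo : ∀ (θ : ℝ) n, Integrable (lop A n θ) μ := fun θ n =>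
    integrable_cont μ (lop_continuous' hA n θ)
  have hxa : ∀ (θ : ℝ) n, Integrable (lal A n θ) μ := fun θ n =>
    integrable_cont μ (lal_continuous' hA n θ)
  have hlow : ∀ n : ℕ, n * J ≤ ∫ θ in (0:ℝ)..1, un μ A θ n := fun n => by
    rw [hJ, ← finite_formula μ hs hA n]
    refine intervalIntegral.integral_mono_on zero_le_one (hwi n) (hui n) fun θ _ => ?_
    exact integral_mono (hxa θ n) (hxo θ n) fun x => lal_le_lop A n θ x
  have hup : ∀ n : ℕ, ∫ θ in (0:ℝ)..1, un μ A θ n ≤ n * J + Real.log 2 := fun n => by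
    have h1 : n * J + Real.log 2 =
        ∫ θ in (0:ℝ)..1, ((∫ x, lal A n θ x ∂μ) + Real.log 2) := by
      rw [intervalIntegral.integral_add (hwi n) (by simp), finite_formula μ hs hA n]
      simp [hJ]
    rw [h1]
    refine intervalIntegral.integral_mono_on zero_le_one (hui n) ((hwi n).add (by simp))
      fun θ _ => ?_
    have h2 : (∫ x, lal A n θ x ∂μ) + Real.log 2 = ∫ x, (lal A n θ x + Real.log 2) ∂μ := by
      rw [integral_add (hxa θ n) (integrable_const _)]; simp
    rw [h2]
    exact integral_mono (hxo θ n) ((hxa θ n).add (integrable_const _))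
      fun x => lop_le_lal A n θ x
  have hlim : Filter.Tendsto (fun n : ℕ => ∫ θ in (0:ℝ)..1, un μ A θ n / n) Filter.atTop
      (nhds (∫ θ in (0:ℝ)..1, lyap μ (fun x => A x * rot (2 * Real.pi * θ)))) := by
    refine intervalIntegral.tendsto_integral_filter_of_dominated_convergence
      (fun _ => ∫ x, Real.log (opNorm (A x : Mat2)) ∂μ) ?_ ?_ (by simp) ?_
    · refine Filter.Eventually.of_forall fun n => ?_
      have := ((hui n).div_const (n : ℝ)).aestronglyMeasurable
      simpa [Set.uIoc_of_le] using this
    · refine Filter.Eventually.of_forall fun n => Filter.Eventually.of_forall fun θ _ => ?_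
      rw [Real.norm_of_nonneg (div_nonneg (un_nonneg μ A θ n) n.cast_nonneg)]
      exact un_le μ hs hA θ n
    · exact Filter.Eventually.of_forall fun θ _ => un_tendsto μ hs hA θ
  refine tendsto_nhds_unique hlim ?_
  have hz : Filter.Tendsto (fun n : ℕ => J + Real.log 2 / n) Filter.atTop (nhds J) := by
    simpa using tendsto_const_nhds.add (tendsto_const_div_atTop_nhds_zero_nat (Real.log 2))
  refine tendsto_of_tendsto_of_tendsto_of_le_of_le' tendsto_const_nhds hz ?_ ?_
  · filter_upwards [Filter.eventually_gt_atTop 0] with n hn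
    have hn' : (0:ℝ) < n := by exact_mod_cast hn
    rw [intervalIntegral.integral_div, le_div_iff₀ hn']
    linarith [hlow n]
  · filter_upwards [Filter.eventually_gt_atTop 0] with n hn
    have hn' : (0:ℝ) < n := by exact_mod_cast hn
    rw [intervalIntegral.integral_div, div_le_iff₀ hn', add_mul, div_mul_cancel₀ _ hn'.ne']
    linarith [hup n]
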